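/- Alexandrov's mixed discriminant inequality: for any (n−1)×(n−1) real symmetric matrix A and positive semidefinite matrices B, M₁, …, M_{n−3}, one has D(A,B,M₁,…,M_{n−3})² ≥ D(A,A,M₁,…,M_{n−3}) · D(B,B,M₁,…,M_{n−3}). -/

import Mathlib

open Matrix

/-- The mixed discriminant of an `m`-tuple of `m × m` real matrices: the symmetric
multilinear polarization of the determinant. -/
noncomputable def mixedDisc {m : ℕ} (M : Fin m → Matrix (Fin m) (Fin m) ℝ) : ℝ :=
  (Nat.factorial m : ℝ)⁻¹ *
    ∑ σ : Equiv.Perm (Fin m), (Matrix.of fun i j => M (σ j) i j).det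

/-- The (unnormalized) mixed discriminant as a multilinear map over a commutative ring. -/
noncomputable def mdMul (R : Type) [CommRing R] (m : ℕ) :
    MultilinearMap R (fun _ : Fin m => Matrix (Fin m) (Fin m) R) R :=
  ∑ σ : Equiv.Perm (Fin m), MultilinearMap.domDomCongr σ
    ((Matrix.detRowAlternating (n := Fin m) (R := R)).toMultilinearMap.compLinearMap
      (fun j => LinearMap.pi fun i => Matrix.entryLinearMap R R i j))

theorem mdMul_apply (R : Type) [CommRing R] (m : ℕ) (M : Fin m → Matrix (Fin m) (Fin m) R) :
    mdMul R m M = ∑ σ : Equiv.Perm (Fin m), (Matrix.of fun i j => M (σ j) i j).det := by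
  unfold mdMul
  rw [MultilinearMap.sum_apply]
  refine Finset.sum_congr rfl fun σ _ => ?_
  rw [← Matrix.det_transpose]
  rfl

theorem mdMul_perm (R : Type) [CommRing R] (m : ℕ) (M : Fin m → Matrix (Fin m) (Fin m) R)
    (τ : Equiv.Perm (Fin m)) : mdMul R m (fun i => M (τ i)) = mdMul R m M := by
  rw [mdMul_apply, mdMul_apply]
  exact Fintype.sum_equiv (Equiv.mulLeft τ) _ _ fun σ => rfl

theorem mdMul_const (R : Type) [CommRing R] (m : ℕ) (Z : Matrix (Fin m) (Fin m) R) :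
    mdMul R m (fun _ => Z) = (Nat.factorial m : R) * Z.det := by
  rw [mdMul_apply]
  have : (Matrix.of fun i j => Z i j) = Z := rfl
  simp [this, Fintype.card_perm]

theorem mdMul_map (m : ℕ) (M : Fin m → Matrix (Fin m) (Fin m) ℝ) :
    mdMul ℂ m (fun i => (M i).map Complex.ofReal) = ((mdMul ℝ m M : ℝ) : ℂ) := by
  rw [mdMul_apply, mdMul_apply, Complex.ofReal_sum]
  refine Finset.sum_congr rfl fun σ _ => ?_
  exact (RingHom.map_det Complex.ofRealHom _).symm

theorem mixedDisc_eq (m : ℕ) (M : Fin m → Matrix (Fin m) (Fin m) ℝ) :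
    mixedDisc M = (Nat.factorial m : ℝ)⁻¹ * mdMul ℝ m M := by
  rw [mdMul_apply]; rfl

open scoped ComplexOrder in
theorem det_ne_zero_of_im {m : ℕ} (X Y : Matrix (Fin m) (Fin m) ℂ) (hX : X.IsHermitian)
    (hY : Y.PosDef) : (X + Complex.I • Y).det ≠ 0 := by
  intro h
  obtain ⟨v, hv, hz⟩ := Matrix.exists_mulVec_eq_zero_iff.mpr h
  have h1 := hX.im_star_dotProduct_mulVec_self v
  have h2 := hY.dotProduct_mulVec_pos hv
  have h3 : star v ⬝ᵥ ((X + Complex.I • Y) *ᵥ v) = 0 := by rw [hz]; simp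
  rw [Matrix.add_mulVec, Matrix.smul_mulVec, dotProduct_add, dotProduct_smul] at h3
  have h4 := congrArg Complex.im h3
  have h5 := (Complex.lt_def.mp h2).1
  simp at h1 h4 h5
  rw [h1] at h4
  linarith

open scoped ComplexOrder in
theorem stable {m : ℕ} (V : Fin m → Matrix (Fin m) (Fin m) ℂ) (S : Finset (Fin m)) :
    (∀ i ∈ S, (V i).PosDef) → ∀ X Y : Matrix (Fin m) (Fin m) ℂ, X.IsHermitian → Y.PosDef →
      mdMul ℂ m (S.piecewise V (fun _ => X + Complex.I • Y)) ≠ 0 := by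
  induction S using Finset.induction_on with
  | empty =>
    intro _ X Y hX hY
    rw [Finset.piecewise_empty, mdMul_const]
    exact mul_ne_zero (by exact_mod_cast Nat.factorial_ne_zero m) (det_ne_zero_of_im X Y hX hY)
  | insert a S ha ih =>
    intro hV X Y hX hY hG
    have hVS : ∀ i ∈ S, (V i).PosDef := fun i hi => hV i (Finset.mem_insert_of_mem hi)
    have hVa : (V a).PosDef := hV a (Finset.mem_insert_self a S)
    have ih := ih hVS
    set Z := X + Complex.I • Y with hZ
    set p : Fin m → Matrix (Fin m) (Fin m) ℂ := S.piecewise 0 (fun _ => V a) with hp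
    set q : Fin m → Matrix (Fin m) (Fin m) ℂ := S.piecewise V (fun _ => Z) with hq
    let f : Polynomial ℂ := ∑ T : Finset (Fin m),
      Polynomial.monomial T.card (mdMul ℂ m (T.piecewise p q))
    have hzero : ∀ T : Finset (Fin m), ∀ i ∈ T, i ∈ S → mdMul ℂ m (T.piecewise p q) = 0 := by
      intro T i hT hS
      apply MultilinearMap.map_coord_zero _ i
      simp [hT, hS, hp]
    have heval : ∀ s : ℂ, f.eval s = mdMul ℂ m (S.piecewise V (fun _ => Z + s • V a)) := by
      intro s
      have e : (S.piecewise V (fun _ => Z + s • V a)) = (fun i => s • p i) + q := by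
        funext i
        by_cases hi : i ∈ S <;> simp [hp, hq, hi, add_comm]
      rw [e, MultilinearMap.map_add_univ, Polynomial.eval_finset_sum]
      refine Finset.sum_congr rfl fun T _ => ?_
      have := (mdMul ℂ m).map_piecewise_smul (fun _ => s) (T.piecewise p q) T
      rw [Finset.prod_const] at this
      rw [Polynomial.eval_monomial, mul_comm, ← smul_eq_mul, ← this]
      congr 1
      funext i
      by_cases hi : i ∈ T <;> simp [hi]
    have hcoeff : ∀ k, f.coeff k = ∑ T : Finset (Fin m),
        if T.card = k then mdMul ℂ m (T.piecewise p q) else 0 := by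
      intro k
      simp only [f, Polynomial.finset_sum_coeff, Polynomial.coeff_monomial]
    have hc1 : f.coeff 1 = 0 := by
      rw [hcoeff]
      refine Finset.sum_eq_zero fun T _ => ?_
      split_ifs with hT
      · obtain ⟨b, rfl⟩ := Finset.card_eq_one.mp hT
        by_cases hb : b ∈ S
        · exact hzero _ b (by simp) hb
        · rw [← mdMul_perm ℂ m _ (Equiv.swap a b), ← hG]
          congr 1
          funext i
          by_cases hia : i = a
          · subst hia
            simp [hp, hb]
          · by_cases hib : i = b
            · subst hib
              have : a ≠ i := fun h => hia h.symm
              simp [hq, ha, hb, hia, this]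
            · rw [Equiv.swap_apply_of_ne_of_ne hia hib]
              by_cases hi : i ∈ S <;> simp [hq, hi, hia, hib]
      · rfl
    have hcd : f.coeff (Sᶜ).card ≠ 0 := by
      rw [hcoeff, Finset.sum_eq_single (Sᶜ)]
      · rw [if_pos rfl]
        have h1 := ih 0 (V a) Matrix.isHermitian_zero hVa
        intro h0
        apply h1
        have := (mdMul ℂ m).map_piecewise_smul (fun _ => Complex.I)
          (S.piecewise V (fun _ => V a)) (Sᶜ)
        have e1 : (Sᶜ.piecewise (fun i => Complex.I • (S.piecewise V (fun _ => V a)) i)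
            (S.piecewise V (fun _ => V a))) = S.piecewise V (fun _ => 0 + Complex.I • V a) := by
          funext i
          by_cases hi : i ∈ S <;> simp [hi]
        have e2 : (Sᶜ.piecewise p q) = S.piecewise V (fun _ => V a) := by
          funext i
          by_cases hi : i ∈ S <;> simp [hi, hp, hq]
        rw [e1, ← e2, h0, smul_zero] at this
        exact this
      · intro T _ hT
        split_ifs with hc
        · by_cases hd : T ⊆ Sᶜ
          · exact absurd (Finset.eq_of_subset_of_card_le hd hc.ge) hT
          · obtain ⟨i, hi, hi'⟩ := Finset.not_subset.mp hd
            exact hzero T i hi (by simpa using hi')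
        · rfl
      · simp
    have hdpos : 0 < (Sᶜ).card := Finset.card_pos.mpr ⟨a, by simpa using ha⟩
    have hdeg : 0 < f.degree :=
      lt_of_lt_of_le (by exact_mod_cast hdpos) (Polynomial.le_degree_of_ne_zero hcd)
    have hder : Polynomial.derivative f ≠ 0 := by
      intro h
      have := Polynomial.natDegree_eq_zero_of_derivative_eq_zero h
      have h2 := Polynomial.natDegree_pos_iff_degree_pos.mpr hdeg
      omega
    have hmem : (0 : ℂ) ∈ (Polynomial.derivative f).rootSet ℂ := by
      rw [Polynomial.mem_rootSet]
      refine ⟨hder, ?_⟩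
      rw [Polynomial.coe_aeval_eq_eval, ← Polynomial.coeff_zero_eq_eval_zero,
        Polynomial.coeff_derivative]
      simp [hc1]
    have hsub : f.rootSet ℂ ⊆ {c : ℂ | c.im < 0} := by
      intro s hs
      rw [Polynomial.mem_rootSet] at hs
      have hs2 := hs.2
      rw [Polynomial.coe_aeval_eq_eval, heval] at hs2
      by_contra hneg
      have him : 0 ≤ s.im := not_lt.mp hneg
      have hP : (Y + s.im • V a).PosDef := hY.add_posSemidef (hVa.posSemidef.smul him)
      have hH : (X + s.re • V a).IsHermitian := by
        refine hX.add ?_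
        unfold Matrix.IsHermitian
        rw [Matrix.conjTranspose_smul, hVa.1.eq]
        simp
      apply ih _ _ hH hP
      rw [← hs2]
      congr 2
      funext _
      rw [hZ]
      ext i j
      simp
      conv_rhs => rw [← Complex.re_add_im s]
      ring
    have := convexHull_min hsub (convex_halfSpace_im_lt 0)
      (Polynomial.rootSet_derivative_subset_convexHull_rootSet hdeg hmem)
    simp at this

open scoped ComplexOrder MatrixOrder in
theorem posSemidef_map {m : ℕ} (B : Matrix (Fin m) (Fin m) ℝ) (hB : B.PosSemidef) :
    (B.map Complex.ofReal).PosSemidef := by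
  obtain ⟨C, hC⟩ := CStarAlgebra.nonneg_iff_eq_star_mul_self.mp hB.nonneg
  have : B.map Complex.ofReal = (C.map Complex.ofReal)ᴴ * C.map Complex.ofReal := by
    subst hC
    ext i j
    simp [Matrix.mul_apply, Matrix.star_eq_conjTranspose]
  rw [this]
  exact Matrix.posSemidef_conjTranspose_mul_self _

open scoped ComplexOrder in
theorem posDef_map {m : ℕ} (B : Matrix (Fin m) (Fin m) ℝ) (hB : B.PosSemidef) (ε : ℝ)
    (hε : 0 < ε) : ((B + ε • (1 : Matrix (Fin m) (Fin m) ℝ)).map Complex.ofReal).PosDef := by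
  have : (B + ε • (1 : Matrix (Fin m) (Fin m) ℝ)).map Complex.ofReal =
      B.map Complex.ofReal + ε • (1 : Matrix (Fin m) (Fin m) ℂ) := by
    ext i j
    by_cases h : i = j <;> simp [h, Matrix.one_apply]
  rw [this]
  exact Matrix.PosDef.posSemidef_add (posSemidef_map B hB) (Matrix.PosDef.one.smul hε)

theorem md_cons_swap {R : Type} [CommRing R] {k : ℕ} (A B : Matrix (Fin (k + 2)) (Fin (k + 2)) R)
    (M : Fin k → Matrix (Fin (k + 2)) (Fin (k + 2)) R) :
    mdMul R (k + 2) (Fin.cons B (Fin.cons A M)) = mdMul R (k + 2) (Fin.cons A (Fin.cons B M)) := by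
  rw [← mdMul_perm R (k + 2) _ (Equiv.swap 0 1)]
  congr 1
  funext i
  refine Fin.cases ?_ (fun i => ?_) i
  · rw [Equiv.swap_apply_left]; rfl
  · refine Fin.cases ?_ (fun i => ?_) i
    · have : (Fin.succ 0 : Fin (k + 2)) = 1 := rfl
      rw [this, Equiv.swap_apply_right]; rfl
    · have h1 : i.succ.succ ≠ (1 : Fin (k + 2)) :=
        fun h => Fin.succ_ne_zero i (Fin.succ_injective _ h)
      rw [Equiv.swap_apply_of_ne_of_ne (Fin.succ_ne_zero _) h1]
      rfl

theorem md_lin0 {R : Type} [CommRing R] {k : ℕ} (A B C : Matrix (Fin (k + 2)) (Fin (k + 2)) R)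
    (M : Fin k → Matrix (Fin (k + 2)) (Fin (k + 2)) R) (t : R) :
    mdMul R (k + 2) (Fin.cons (A + t • B) (Fin.cons C M)) =
      mdMul R (k + 2) (Fin.cons A (Fin.cons C M)) +
        t * mdMul R (k + 2) (Fin.cons B (Fin.cons C M)) := by
  rw [MultilinearMap.cons_add, MultilinearMap.cons_smul, smul_eq_mul]

theorem md_quad {R : Type} [CommRing R] {k : ℕ} (A B : Matrix (Fin (k + 2)) (Fin (k + 2)) R)
    (M : Fin k → Matrix (Fin (k + 2)) (Fin (k + 2)) R) (t : R) :
    mdMul R (k + 2) (Fin.cons (A + t • B) (Fin.cons (A + t • B) M)) =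
      mdMul R (k + 2) (Fin.cons A (Fin.cons A M)) +
        2 * t * mdMul R (k + 2) (Fin.cons A (Fin.cons B M)) +
        t ^ 2 * mdMul R (k + 2) (Fin.cons B (Fin.cons B M)) := by
  rw [md_lin0, ← md_cons_swap A, ← md_cons_swap B, md_lin0, md_lin0, md_cons_swap A B]
  ring

theorem md_map_cons {k : ℕ} (A B : Matrix (Fin (k + 2)) (Fin (k + 2)) ℝ)
    (M : Fin k → Matrix (Fin (k + 2)) (Fin (k + 2)) ℝ) :
    mdMul ℂ (k + 2) (Fin.cons (A.map Complex.ofReal) (Fin.cons (B.map Complex.ofReal)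
      (fun i => (M i).map Complex.ofReal))) =
      ((mdMul ℝ (k + 2) (Fin.cons A (Fin.cons B M)) : ℝ) : ℂ) := by
  rw [← mdMul_map]
  congr 1
  funext i
  refine Fin.cases rfl (fun i => ?_) i
  refine Fin.cases rfl (fun i => ?_) i
  rfl

open scoped ComplexOrder in
theorem md_pd {k : ℕ} (A B : Matrix (Fin (k + 2)) (Fin (k + 2)) ℝ)
    (M : Fin k → Matrix (Fin (k + 2)) (Fin (k + 2)) ℝ)
    (hA : A.IsSymm) (hB : (B.map Complex.ofReal).PosDef)
    (hM : ∀ i, ((M i).map Complex.ofReal).PosDef) :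
    mdMul ℝ (k + 2) (Fin.cons A (Fin.cons A M)) * mdMul ℝ (k + 2) (Fin.cons B (Fin.cons B M)) ≤
    mdMul ℝ (k + 2) (Fin.cons A (Fin.cons B M)) ^ 2 := by
  by_contra hlt
  rw [not_le] at hlt
  have ha := md_map_cons A A M
  have hb := md_map_cons A B M
  have hc := md_map_cons B B M
  set a := mdMul ℝ (k + 2) (Fin.cons A (Fin.cons A M))
  set b := mdMul ℝ (k + 2) (Fin.cons A (Fin.cons B M))
  set c := mdMul ℝ (k + 2) (Fin.cons B (Fin.cons B M))
  set A' := A.map Complex.ofReal with hA'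
  set B' := B.map Complex.ofReal with hB'
  set M' := fun i => (M i).map Complex.ofReal with hM'
  have hc0 : c ≠ 0 := by
    rintro h
    rw [h] at hlt
    nlinarith [sq_nonneg b]
  let x : ℝ := -b / c
  let y : ℝ := Real.sqrt (a * c - b ^ 2) / |c|
  have hy : 0 < y := div_pos (Real.sqrt_pos.mpr (by linarith)) (abs_pos.mpr hc0)
  have hy2 : y ^ 2 = (a * c - b ^ 2) / c ^ 2 := by
    simp only [y]
    rw [div_pow, Real.sq_sqrt (by linarith), sq_abs]
  have hH : (A' + x • B').IsHermitian := by
    have h1 : A'.IsHermitian := by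
      ext i j
      simp [hA', hA.apply i j]
    refine h1.add ?_
    unfold Matrix.IsHermitian
    rw [Matrix.conjTranspose_smul, hB.1.eq]
    simp
  have hS := stable (Fin.cons A' (Fin.cons A' M') : Fin (k + 2) → _) ({0, 1}ᶜ) (by
    intro i
    refine Fin.cases (by simp) (fun i => ?_) i
    refine Fin.cases (by simp) (fun i => ?_) i
    intro _
    exact hM i) (A' + x • B') (y • B') hH (hB.smul hy)
  have hZ : A' + x • B' + Complex.I • (y • B') = A' + ((x : ℂ) + y * Complex.I) • B' := by
    ext i j
    simp
    ring
  rw [hZ] at hS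
  have e : (({0, 1}ᶜ : Finset (Fin (k + 2))).piecewise (Fin.cons A' (Fin.cons A' M') : Fin (k + 2) → Matrix (Fin (k + 2)) (Fin (k + 2)) ℂ)
      (fun _ => A' + ((x : ℂ) + y * Complex.I) • B')) =
      Fin.cons (A' + ((x : ℂ) + y * Complex.I) • B')
        (Fin.cons (A' + ((x : ℂ) + y * Complex.I) • B') M') := by
    funext i
    refine Fin.cases (by simp) (fun i => ?_) i
    refine Fin.cases (by simp) (fun i => ?_) i
    have h1 : i.succ.succ ≠ (1 : Fin (k + 2)) :=
      fun h => Fin.succ_ne_zero i (Fin.succ_injective _ h)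
    rw [Finset.piecewise_eq_of_mem]
    · rfl
    · simp [h1]
  rw [e, md_quad, ha, hb, hc] at hS
  apply hS
  have hx : x * c = -b := by simp only [x]; field_simp
  have hy3 : y ^ 2 * c ^ 2 = a * c - b ^ 2 := by rw [hy2]; field_simp
  have hre : a + 2 * x * b + (x ^ 2 - y ^ 2) * c = 0 := by
    apply mul_left_cancel₀ hc0
    linear_combination (2 * b + x * c - b) * hx - hy3
  have him : 2 * y * b + 2 * x * y * c = 0 := by
    linear_combination 2 * y * hx
  apply Complex.ext
  · simp [pow_two]
    linear_combination hre
  · simp [pow_two]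
    linear_combination him

theorem md_continuous {k : ℕ} (F : ℝ → Fin k → Matrix (Fin k) (Fin k) ℝ)
    (hF : ∀ i, Continuous fun t => F t i) : Continuous fun t => mdMul ℝ k (F t) := by
  simp only [mdMul_apply]
  refine continuous_finset_sum _ fun σ _ => ?_
  refine Continuous.matrix_det ?_
  refine continuous_matrix fun i j => ?_
  exact (hF (σ j)).matrix_elem i j

theorem md_psd {k : ℕ} (A B : Matrix (Fin (k + 2)) (Fin (k + 2)) ℝ)
    (M : Fin k → Matrix (Fin (k + 2)) (Fin (k + 2)) ℝ)
    (hA : A.IsSymm) (hB : B.PosSemidef) (hM : ∀ i, (M i).PosSemidef) :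
    mdMul ℝ (k + 2) (Fin.cons A (Fin.cons A M)) * mdMul ℝ (k + 2) (Fin.cons B (Fin.cons B M)) ≤
    mdMul ℝ (k + 2) (Fin.cons A (Fin.cons B M)) ^ 2 := by
  let E : ℝ → Matrix (Fin (k + 2)) (Fin (k + 2)) ℝ → Matrix (Fin (k + 2)) (Fin (k + 2)) ℝ :=
    fun t X => X + t • 1
  have hE : ∀ X, Continuous fun t => E t X := fun X => by
    simp only [E]
    fun_prop
  have hE0 : ∀ X, E 0 X = X := fun X => by simp [E]
  have hcont : ∀ P Q : ℝ → Matrix (Fin (k + 2)) (Fin (k + 2)) ℝ, Continuous P → Continuous Q →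
      Continuous fun t => mdMul ℝ (k + 2) (Fin.cons (P t) (Fin.cons (Q t) fun i => E t (M i))) := by
    intro P Q hP hQ
    apply md_continuous
    intro i
    refine Fin.cases hP (fun i => ?_) i
    refine Fin.cases hQ (fun i => ?_) i
    exact hE (M i)
  have hl := (hcont (fun _ => A) (fun _ => A) continuous_const continuous_const).mul
    (hcont (fun t => E t B) (fun t => E t B) (hE B) (hE B))
  have hr := (hcont (fun _ => A) (fun t => E t B) continuous_const (hE B)).pow 2
  have key := le_of_tendsto_of_tendsto
    ((hl.tendsto 0).mono_left (nhdsWithin_le_nhds (s := Set.Ioi 0)))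
    ((hr.tendsto 0).mono_left (nhdsWithin_le_nhds (s := Set.Ioi 0)))
    (by
      filter_upwards [self_mem_nhdsWithin] with t ht
      exact md_pd A (E t B) (fun i => E t (M i)) hA (posDef_map B hB t ht)
        (fun i => posDef_map (M i) (hM i) t ht))
  simpa only [hE0, Pi.mul_apply, Pi.pow_apply] using key

theorem stmt19 {k : ℕ} (A B : Matrix (Fin (k + 2)) (Fin (k + 2)) ℝ)
    (M : Fin k → Matrix (Fin (k + 2)) (Fin (k + 2)) ℝ)
    (hA : A.IsSymm) (hB : B.PosSemidef) (hM : ∀ i, (M i).PosSemidef) :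
    mixedDisc (Fin.cons A (Fin.cons B M)) ^ 2 ≥
      mixedDisc (Fin.cons A (Fin.cons A M)) * mixedDisc (Fin.cons B (Fin.cons B M)) := by
  rw [mixedDisc_eq, mixedDisc_eq, mixedDisc_eq]
  have h := mul_le_mul_of_nonneg_left (md_psd A B M hA hB hM)
    (sq_nonneg ((Nat.factorial (k + 2) : ℝ)⁻¹))
  rw [ge_iff_le, mul_pow]
  refine le_trans (le_of_eq ?_) h
  ring
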